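/- For every ε > 0 there exists a constant C > 0 such that for every integer m ≥ 2 there exists a function f : {0,1}^m → ℝ≥0 with deg_sos(f) ≤ C · m^{1/2+ε} · log m satisfying: (1) f(0^m) = 0; (2) f(z) = |z| - 1 for every z with 1 ≤ |z| ≤ m^{2ε}; and (3) |z| - 1 - 2^{-m^{2ε}} ≤ f(z) ≤ |z| - 1 for every z with |z| > m^{2ε}. -/

import Mathlib

/-- `f : {0,1}^m → ℝ` has sum-of-squares degree at most `d`. -/
def HasSosDeg (m d : ℕ) (f : (Fin m → Bool) → ℝ) : Prop :=
  ∃ (k : ℕ) (p : Fin k → MvPolynomial (Fin m) ℝ),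
    (∀ i, (p i).totalDegree ≤ d) ∧
    ∀ z, f z = ∑ i, (MvPolynomial.eval (fun j => if z j then (1 : ℝ) else 0) (p i)) ^ 2

/-- The Hamming weight of `z ∈ {0,1}^m`. -/
def hw {m : ℕ} (z : Fin m → Bool) : ℕ := (Finset.univ.filter fun i => z i).card

namespace SosAux

/-- A sum of squares indexed by an arbitrary finite type. -/
theorem of_fintype {m d : ℕ} {f : (Fin m → Bool) → ℝ} {ι : Type} [Fintype ι]
    (p : ι → MvPolynomial (Fin m) ℝ) (hp : ∀ i, (p i).totalDegree ≤ d)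
    (h : ∀ z, f z = ∑ i, (MvPolynomial.eval (fun j => if z j then (1 : ℝ) else 0) (p i)) ^ 2) :
    HasSosDeg m d f := by
  refine ⟨Fintype.card ι, fun i => p ((Fintype.equivFin ι).symm i), fun i => hp _, fun z => ?_⟩
  rw [h z]
  exact (Equiv.sum_comp (Fintype.equivFin ι).symm
    (fun i => (MvPolynomial.eval (fun j => if z j then (1 : ℝ) else 0) (p i)) ^ 2)).symm

theorem nonneg {m d : ℕ} {f : (Fin m → Bool) → ℝ} (h : HasSosDeg m d f) (z) : 0 ≤ f z := by
  obtain ⟨k, p, -, h⟩ := h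
  rw [h z]
  positivity

theorem mono {m d e : ℕ} {f : (Fin m → Bool) → ℝ} (h : HasSosDeg m d f) (hde : d ≤ e) :
    HasSosDeg m e f := by
  obtain ⟨k, p, hp, h⟩ := h
  exact ⟨k, p, fun i => (hp i).trans hde, h⟩

theorem add {m d : ℕ} {f g : (Fin m → Bool) → ℝ} (hf : HasSosDeg m d f)
    (hg : HasSosDeg m d g) : HasSosDeg m d (fun z => f z + g z) := by
  obtain ⟨k, p, hp, h⟩ := hf
  obtain ⟨l, q, hq, h'⟩ := hg
  refine of_fintype (ι := Fin k ⊕ Fin l) (Sum.elim p q) ?_ ?_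
  · rintro (i | i)
    · exact hp i
    · exact hq i
  · intro z
    simp [h z, h' z]

theorem mul {m d e : ℕ} {f g : (Fin m → Bool) → ℝ} (hf : HasSosDeg m d f)
    (hg : HasSosDeg m e g) : HasSosDeg m (d + e) (fun z => f z * g z) := by
  obtain ⟨k, p, hp, h⟩ := hf
  obtain ⟨l, q, hq, h'⟩ := hg
  refine of_fintype (ι := Fin k × Fin l) (fun i => p i.1 * q i.2) ?_ ?_
  · rintro ⟨i, j⟩
    exact (MvPolynomial.totalDegree_mul _ _).trans (add_le_add (hp i) (hq j))
  · intro z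
    rw [h z, h' z, Finset.sum_mul_sum, Fintype.sum_prod_type]
    simp [mul_pow]

theorem const {m : ℕ} (a : ℝ) (ha : 0 ≤ a) : HasSosDeg m 0 (fun _ => a) := by
  refine of_fintype (ι := Unit) (fun _ => MvPolynomial.C (Real.sqrt a)) ?_ ?_
  · simp
  · simp [Real.sq_sqrt ha]

theorem smul {m d : ℕ} {f : (Fin m → Bool) → ℝ} (a : ℝ) (ha : 0 ≤ a) (hf : HasSosDeg m d f) :
    HasSosDeg m d (fun z => a * f z) := by
  have := mul (const a ha) hf
  rwa [zero_add] at this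

theorem hw_eq {m : ℕ} (z : Fin m → Bool) :
    (hw z : ℝ) = ∑ i, (if z i then (1 : ℝ) else 0) := by
  simp [hw]

theorem hw_le {m : ℕ} (z : Fin m → Bool) : hw z ≤ m := by
  unfold hw
  exact (Finset.card_le_univ _).trans (by simp)

theorem sos_compl {m : ℕ} : HasSosDeg m 1 (fun z => (m : ℝ) - hw z) := by
  refine of_fintype (ι := Fin m) (fun i => 1 - MvPolynomial.X i) ?_ ?_
  · intro i
    refine (MvPolynomial.totalDegree_sub _ _).trans ?_
    simp
  · intro z
    rw [hw_eq]
    have : (m : ℝ) = ∑ i : Fin m, (1 : ℝ) := by simp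
    rw [this, ← Finset.sum_sub_distrib]
    refine Finset.sum_congr rfl fun i _ => ?_
    cases h : z i <;> simp [h]

theorem sos_pair {m : ℕ} : HasSosDeg m 2 (fun z => (hw z : ℝ) * ((hw z : ℝ) - 1)) := by
  refine of_fintype (ι := Fin m × Fin m)
    (fun i => if i.1 = i.2 then 0 else MvPolynomial.X i.1 * MvPolynomial.X i.2) ?_ ?_
  · rintro ⟨i, j⟩
    dsimp only
    split_ifs
    · simp
    · refine (MvPolynomial.totalDegree_mul _ _).trans ?_
      simp
  · intro z
    have h1 : (hw z : ℝ) * ((hw z : ℝ) - 1) = (hw z : ℝ) * hw z - hw z := by ring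
    rw [h1]
    have h2 : (hw z : ℝ) * hw z = ∑ i, ∑ j, (if z i then (1 : ℝ) else 0) *
        (if z j then (1 : ℝ) else 0) := by
      rw [← Finset.sum_mul_sum, ← hw_eq]
    have h3 : (hw z : ℝ) = ∑ i, ∑ j, (if i = j then (if z i then (1 : ℝ) else 0) else 0) := by
      rw [hw_eq]; simp
    rw [h2, h3, ← Finset.sum_sub_distrib, Fintype.sum_prod_type]
    refine Finset.sum_congr rfl fun i _ => ?_
    rw [← Finset.sum_sub_distrib]
    refine Finset.sum_congr rfl fun j _ => ?_
    by_cases hij : i = j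
    · subst hij
      cases z i <;> simp
    · cases h : z i <;> cases h' : z j <;> simp [h, h', hij]

/-- Squares of univariate polynomials in the Hamming weight. -/
theorem sos_poly {m d : ℕ} (q : Polynomial ℝ) (a b : ℝ) (hq : q.natDegree ≤ d) :
    HasSosDeg m d (fun z => (q.eval (a + b * hw z)) ^ 2) := by
  let L : MvPolynomial (Fin m) ℝ :=
    MvPolynomial.C a + MvPolynomial.C b * ∑ i, MvPolynomial.X i
  have hL : L.totalDegree ≤ 1 := by
    refine (MvPolynomial.totalDegree_add _ _).trans (max_le (by simp) ?_)
    refine (MvPolynomial.totalDegree_mul _ _).trans ?_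
    rw [MvPolynomial.totalDegree_C, zero_add]
    refine MvPolynomial.totalDegree_finsetSum_le ?_
    simp
  refine of_fintype (ι := Unit) (fun _ => Polynomial.aeval L q) ?_ ?_
  · intro _
    rw [Polynomial.aeval_eq_sum_range]
    refine MvPolynomial.totalDegree_finsetSum_le ?_
    intro i hi
    refine (MvPolynomial.totalDegree_smul_le _ _).trans ?_
    refine (MvPolynomial.totalDegree_pow _ _).trans ?_
    have : i ≤ d := by
      have := Finset.mem_range.1 hi
      omega
    nlinarith
  · intro z
    simp only [Finset.univ_unique, Finset.sum_const, Finset.card_singleton, one_smul]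
    congr 1
    rw [← MvPolynomial.coe_aeval_eq_eval, RingHom.coe_coe, ← Polynomial.aeval_algHom_apply]
    rw [MvPolynomial.aeval_eq_eval, Polynomial.coe_aeval_eq_eval]
    congr 1
    simp [L, hw_eq]

/-- `p` is a sum of squares of degree `d` with `1 - p = |z| · r`, `r` a sum of squares. -/
def Good (m d : ℕ) (p : (Fin m → Bool) → ℝ) : Prop :=
  HasSosDeg m d p ∧ ∃ r, HasSosDeg m d r ∧ ∀ z, 1 - p z = hw z * r z

theorem Good.le_one {m d : ℕ} {p : (Fin m → Bool) → ℝ} (h : Good m d p) (z) : p z ≤ 1 := by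
  obtain ⟨-, r, hr, h⟩ := h
  have := h z
  have h1 := nonneg hr z
  have : 0 ≤ (hw z : ℝ) * r z := by positivity
  linarith

theorem Good.nonneg {m d : ℕ} {p : (Fin m → Bool) → ℝ} (h : Good m d p) (z) : 0 ≤ p z :=
  SosAux.nonneg h.1 z

theorem Good.one {m : ℕ} : Good m 0 (fun _ => 1) :=
  ⟨const 1 zero_le_one, fun _ => 0, const 0 le_rfl, by simp⟩

theorem Good.mul {m d e : ℕ} {p q : (Fin m → Bool) → ℝ} (hp : Good m d p) (hq : Good m e q) :
    Good m (d + e) (fun z => p z * q z) := by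
  obtain ⟨hp, r, hr, h⟩ := hp
  obtain ⟨hq, s, hs, h'⟩ := hq
  refine ⟨SosAux.mul hp hq, fun z => r z + p z * s z,
    SosAux.add (mono hr (by omega)) (SosAux.mul hp hs), fun z => ?_⟩
  linear_combination h z + p z * h' z

theorem Good.pow {m d : ℕ} {p : (Fin m → Bool) → ℝ} (hp : Good m d p) (s : ℕ) :
    Good m (d * s) (fun z => p z ^ s) := by
  induction s with
  | zero => simpa using Good.one
  | succ s ih => simpa [pow_succ, mul_add] using ih.mul hp

theorem Good.prod {m : ℕ} (d : ℕ → ℕ) (p : ℕ → (Fin m → Bool) → ℝ) (s : Finset ℕ)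
    (h : ∀ j ∈ s, Good m (d j) (p j)) :
    Good m (∑ j ∈ s, d j) (fun z => ∏ j ∈ s, p j z) := by
  induction s using Finset.induction_on with
  | empty => simpa using Good.one
  | insert a s ha ih =>
    simp only [Finset.prod_insert ha, Finset.sum_insert ha]
    exact (h a (by simp)).mul (ih fun j hj => h j (by simp [hj]))

theorem sos_sum {m d : ℕ} (p : ℕ → (Fin m → Bool) → ℝ) (s : Finset ℕ)
    (h : ∀ j ∈ s, HasSosDeg m d (p j)) : HasSosDeg m d (fun z => ∑ j ∈ s, p j z) := by
  induction s using Finset.induction_on with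
  | empty => simpa using mono (const 0 le_rfl) (Nat.zero_le d)
  | insert a s ha ih =>
    simp only [Finset.sum_insert ha]
    exact add (h a (by simp)) (ih fun j hj => h j (by simp [hj]))

theorem Good.mono {m d e : ℕ} {p : (Fin m → Bool) → ℝ} (h : Good m d p) (hde : d ≤ e) :
    Good m e p := by
  obtain ⟨hp, r, hr, h⟩ := h
  exact ⟨SosAux.mono hp hde, r, SosAux.mono hr hde, h⟩

theorem Good.avg {m d N : ℕ} (hN : 0 < N) (p : ℕ → (Fin m → Bool) → ℝ)
    (h : ∀ j < N, Good m d (p j)) :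
    Good m d (fun z => (1 / N : ℝ) * ∑ j ∈ Finset.range N, p j z) := by
  choose! hp r hr hpr using h
  refine ⟨smul _ (by positivity) (sos_sum _ _ fun j hj => hp j (Finset.mem_range.1 hj)),
    fun z => (1 / N : ℝ) * ∑ j ∈ Finset.range N, r j z,
    smul _ (by positivity) (sos_sum _ _ fun j hj => hr j (Finset.mem_range.1 hj)), fun z => ?_⟩
  have : ∑ j ∈ Finset.range N, (1 - p j z) = ∑ j ∈ Finset.range N, hw z * r j z :=
    Finset.sum_congr rfl fun j hj => hpr j (Finset.mem_range.1 hj) z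
  rw [Finset.sum_sub_distrib, ← Finset.mul_sum] at this
  simp only [Finset.sum_const, Finset.card_range, nsmul_eq_mul, mul_one] at this
  have hN' : (N : ℝ) ≠ 0 := by positivity
  field_simp
  linarith

theorem pell (n : ℕ) (y : ℝ) (h1 : -1 ≤ y) (h2 : y ≤ 1) :
    1 - ((Polynomial.Chebyshev.T ℝ (n + 1 : ℕ)).eval y) ^ 2 =
      (1 - y ^ 2) * ((Polynomial.Chebyshev.U ℝ (n : ℕ)).eval y) ^ 2 := by
  obtain ⟨θ, rfl⟩ : ∃ θ, Real.cos θ = y := ⟨_, Real.cos_arccos h1 h2⟩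
  have hU := Polynomial.Chebyshev.U_real_cos θ n
  rw [Polynomial.Chebyshev.T_real_cos]
  have hs : 1 - Real.cos θ ^ 2 = Real.sin θ ^ 2 := by
    linarith [Real.sin_sq_add_cos_sq θ]
  rw [hs, ← mul_pow, mul_comm (Real.sin θ), hU]
  push_cast
  linarith [Real.sin_sq_add_cos_sq ((n + 1 : ℝ) * θ)]

/-- Squared Chebyshev polynomials are good. -/
theorem Good.cheb {m : ℕ} (n : ℕ) (c : ℝ) (hc : 0 ≤ c) (hcm : c * m ≤ 2) :
    Good m n (fun z => ((Polynomial.Chebyshev.T ℝ n).eval (1 + (-c) * hw z)) ^ 2) := by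
  refine ⟨sos_poly _ _ _ (by simp), ?_⟩
  rcases n with _ | n
  · exact ⟨fun _ => 0, const 0 le_rfl, by simp⟩
  · refine ⟨fun z => (c * ((2 - c * m) + c * (m - hw z))) *
      ((Polynomial.Chebyshev.U ℝ n).eval (1 + (-c) * hw z)) ^ 2, ?_, ?_⟩
    · rw [add_comm]
      refine SosAux.mul ?_ (sos_poly _ _ _ (by simp))
      refine smul c hc (SosAux.add (SosAux.mono (const _ (by linarith)) zero_le_one)
        (smul c hc sos_compl))
    · intro z
      have hz : (hw z : ℝ) ≤ m := by exact_mod_cast hw_le z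
      have hz0 : (0 : ℝ) ≤ hw z := by positivity
      have := mul_le_mul_of_nonneg_left hz hc
      have := mul_nonneg hc hz0
      rw [pell n _ (by linarith) (by linarith)]
      ring

theorem sum_cos (N : ℕ) (θ : ℝ) :
    2 * Real.sin θ * ∑ i ∈ Finset.range N, Real.cos (2 * (i * θ)) =
      Real.sin ((2 * N - 1) * θ) + Real.sin θ := by
  induction N with
  | zero => simp
  | succ N ih =>
    rw [Finset.sum_range_succ, mul_add, ih]
    have e1 : (2 * ((N + 1 : ℕ) : ℝ) - 1) * θ = 2 * (N * θ) + θ := by push_cast; ring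
    have e2 : (2 * (N : ℝ) - 1) * θ = 2 * (N * θ) - θ := by ring
    rw [e1, e2, Real.sin_add, Real.sin_sub]
    ring

theorem avg_bound (N : ℕ) (hN : 0 < N) (y : ℝ) (h1 : -1 ≤ y) (h2 : y ≤ 1)
    (h : 4 ≤ (N : ℝ) ^ 2 * (1 - y ^ 2)) :
    (1 / N : ℝ) * ∑ i ∈ Finset.range N, ((Polynomial.Chebyshev.T ℝ i).eval y) ^ 2 ≤ 3 / 4 := by
  have hs : Real.sin (Real.arccos y) = Real.sqrt (1 - y ^ 2) := Real.sin_arccos y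
  have hc : Real.cos (Real.arccos y) = y := Real.cos_arccos h1 h2
  generalize Real.arccos y = θ at hs hc
  subst hc
  have hNs : 2 ≤ N * Real.sin θ := by
    rw [hs]
    have hN0 : (0 : ℝ) ≤ N := by positivity
    calc (2 : ℝ) = Real.sqrt 4 := by
          rw [show (4 : ℝ) = 2 ^ 2 by norm_num]; simp
      _ ≤ Real.sqrt ((N : ℝ) ^ 2 * (1 - Real.cos θ ^ 2)) := Real.sqrt_le_sqrt h
      _ = _ := by rw [Real.sqrt_mul (by positivity), Real.sqrt_sq hN0]
  have hN0 : (0 : ℝ) < N := by positivity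
  have hs0 : 0 < Real.sin θ := by
    by_contra hh
    push Not at hh
    nlinarith
  have key := sum_cos N θ
  have e : ∑ i ∈ Finset.range N, ((Polynomial.Chebyshev.T ℝ i).eval (Real.cos θ)) ^ 2 =
      N / 2 + (∑ i ∈ Finset.range N, Real.cos (2 * (i * θ))) / 2 := by
    rw [Finset.sum_div]
    have : (N : ℝ) / 2 = ∑ i ∈ Finset.range N, (1 / 2 : ℝ) := by simp; ring
    rw [this, ← Finset.sum_add_distrib]
    refine Finset.sum_congr rfl fun i _ => ?_
    rw [Polynomial.Chebyshev.T_real_cos, Real.cos_sq]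
    push_cast
    ring
  rw [e]
  set S := ∑ i ∈ Finset.range N, Real.cos (2 * (i * θ))
  have hb1 := Real.sin_le_one ((2 * N - 1) * θ)
  have hb2 := Real.sin_le_one θ
  have hS : S ≤ N / 2 := by
    have : Real.sin θ * S ≤ Real.sin θ * (N / 2) := by nlinarith
    exact le_of_mul_le_mul_left this hs0
  rw [one_div, inv_mul_le_iff₀ hN0]
  linarith

/-- A good function vanishing at weight `j`. -/
theorem exists_root {m : ℕ} (j : ℕ) (hj : 1 ≤ j) (hjm : j ≤ m) :
    ∃ (d : ℕ) (p : (Fin m → Bool) → ℝ), Good m d p ∧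
      (d : ℝ) ≤ 2 * Real.sqrt m * (1 / Real.sqrt j) ∧ ∀ z, hw z = j → p z = 0 := by
  have hj0 : (0 : ℝ) < j := by exact_mod_cast hj
  have hjm' : (j : ℝ) ≤ m := by exact_mod_cast hjm
  have hm0 : (0 : ℝ) < m := by linarith
  set q := Real.sqrt m * (1 / Real.sqrt j) with hq
  have hsj : 0 < Real.sqrt j := Real.sqrt_pos.2 hj0
  have hq1 : 1 ≤ q := by
    rw [hq, mul_one_div, le_div_iff₀ hsj, one_mul]
    exact Real.sqrt_le_sqrt hjm'
  have hqsq : q ^ 2 * j = m := by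
    rw [hq, mul_pow, div_pow, Real.sq_sqrt hm0.le, Real.sq_sqrt hj0.le]
    field_simp
  set n := ⌈q⌉₊ with hn
  have hqn : q ≤ n := Nat.le_ceil q
  have hnq : (n : ℝ) ≤ 2 * q := by
    have := Nat.ceil_lt_add_one (show 0 ≤ q by linarith)
    linarith
  have hn0 : (0 : ℝ) < n := by linarith
  set t := Real.pi / (2 * n) with ht
  set c := (1 - Real.cos t) / j with hc
  have hc0 : 0 ≤ c := div_nonneg (by linarith [Real.cos_le_one t]) hj0.le
  have hcm : c * m ≤ 2 := by
    have h1 : 1 - Real.cos t ≤ 2 / (n : ℝ) ^ 2 := by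
      have := Real.one_sub_sq_div_two_le_cos (x := t)
      have h2 : t ^ 2 / 2 ≤ 2 / (n : ℝ) ^ 2 := by
        rw [ht, div_pow, mul_pow]
        rw [div_div, div_le_div_iff₀ (by positivity) (by positivity)]
        have : Real.pi ^ 2 ≤ 16 := by nlinarith [Real.pi_pos, Real.pi_le_four]
        nlinarith [sq_nonneg (n : ℝ)]
      linarith
    have h3 : (m : ℝ) ≤ (n : ℝ) ^ 2 * j := by
      rw [← hqsq]
      gcongr
    calc c * m = (1 - Real.cos t) * (m / j) := by rw [hc]; ring
      _ ≤ (2 / (n : ℝ) ^ 2) * (m / j) := by gcongr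
      _ ≤ (2 / (n : ℝ) ^ 2) * ((n : ℝ) ^ 2 * j / j) := by gcongr
      _ = 2 := by field_simp
  refine ⟨n, _, Good.cheb n c hc0 hcm, by rw [mul_assoc]; exact hnq, fun z hz => ?_⟩
  have e : 1 + (-c) * (hw z : ℝ) = Real.cos t := by
    rw [hz, hc]
    field_simp
    ring
  have e2 : ((n : ℤ) : ℝ) * t = Real.pi / 2 := by
    rw [ht]; push_cast; field_simp
  simp only [e]
  rw [Polynomial.Chebyshev.T_real_cos, e2]
  simp

theorem sum_inv_sqrt (J : ℕ) :
    ∑ j ∈ Finset.Icc 1 J, 1 / Real.sqrt j ≤ 2 * Real.sqrt J := by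
  induction J with
  | zero => simp
  | succ J ih =>
    rw [Finset.sum_Icc_succ_top (by omega)]
    have hJ : (0 : ℝ) ≤ J := by positivity
    push_cast
    have h1 := Real.sq_sqrt hJ
    have h2 := Real.sq_sqrt (show (0 : ℝ) ≤ J + 1 by positivity)
    have h3 : 0 < Real.sqrt ((J : ℝ) + 1) := Real.sqrt_pos.2 (by positivity)
    have h4 := Real.sqrt_nonneg (J : ℝ)
    set a := Real.sqrt (J : ℝ)
    set b := Real.sqrt ((J : ℝ) + 1)
    have : 1 / b ≤ 2 * b - 2 * a := by
      rw [div_le_iff₀ h3]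
      nlinarith [sq_nonneg (a - b)]
    linarith

/-- A good function vanishing at all weights `1..J`. -/
theorem exists_roots {m : ℕ} (J : ℕ) (hJm : J ≤ m) :
    ∃ (d : ℕ) (p : (Fin m → Bool) → ℝ), Good m d p ∧
      (d : ℝ) ≤ 4 * Real.sqrt m * Real.sqrt J ∧ ∀ z, 1 ≤ hw z → hw z ≤ J → p z = 0 := by
  have H : ∀ j ∈ Finset.Icc 1 J, ∃ (d : ℕ) (p : (Fin m → Bool) → ℝ), Good m d p ∧
      (d : ℝ) ≤ 2 * Real.sqrt m * (1 / Real.sqrt j) ∧ ∀ z, hw z = j → p z = 0 := by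
    intro j hj
    rw [Finset.mem_Icc] at hj
    exact exists_root j hj.1 (hj.2.trans hJm)
  choose! d p hg hd hz using H
  refine ⟨_, _, Good.prod d p _ hg, ?_, fun z h1 h2 => ?_⟩
  · push_cast
    refine (Finset.sum_le_sum hd).trans ?_
    rw [← Finset.mul_sum]
    have := mul_le_mul_of_nonneg_left (sum_inv_sqrt J)
      (show 0 ≤ 2 * Real.sqrt m by positivity)
    linarith
  · have hmem : hw z ∈ Finset.Icc 1 J := Finset.mem_Icc.2 ⟨h1, h2⟩
    exact Finset.prod_eq_zero hmem (hz _ hmem z rfl)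

/-- A good function that is tiny at weights above `T`. -/
theorem exists_small {m : ℕ} (hm : 2 ≤ m) (T : ℝ) (hT : 1 ≤ T) :
    ∃ (d : ℕ) (p : (Fin m → Bool) → ℝ), Good m d p ∧
      (d : ℝ) ≤ 3 * (Real.sqrt m * Real.sqrt T) * (4 + 5 * Real.log m) ∧
      ∀ z, T < hw z → p z ≤ 2 ^ (-T) / m := by
  have hm2 : (2 : ℝ) ≤ m := by exact_mod_cast hm
  have hm0 : (0 : ℝ) < m := by linarith
  have hlog : 0 ≤ Real.log m := Real.log_nonneg (by linarith)
  rcases le_or_gt (m : ℝ) T with hmT | hTm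
  · refine ⟨0, _, Good.one, by push_cast; positivity, fun z hz => ?_⟩
    have : (hw z : ℝ) ≤ m := by exact_mod_cast hw_le z
    linarith
  have hT0 : 0 < T := by linarith
  have hsT : 0 < Real.sqrt T := Real.sqrt_pos.2 hT0
  set q := Real.sqrt m / Real.sqrt T with hq
  have hq1 : 1 ≤ q := by
    rw [hq, le_div_iff₀ hsT, one_mul]
    exact Real.sqrt_le_sqrt hTm.le
  have hqsq : q ^ 2 * T = m := by
    rw [hq, div_pow, Real.sq_sqrt hm0.le, Real.sq_sqrt hT0.le]
    field_simp
  have hqT : q * T = Real.sqrt m * Real.sqrt T := by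
    rw [hq]
    nth_rewrite 2 [← Real.sq_sqrt hT0.le]
    field_simp
  set N := ⌈2 * q⌉₊ with hN
  have hqN : 2 * q ≤ N := Nat.le_ceil _
  have hNq : (N : ℝ) ≤ 3 * q := by
    have := Nat.ceil_lt_add_one (show 0 ≤ 2 * q by linarith)
    linarith
  have hN0 : 0 < N := by
    have : (0 : ℝ) < N := by linarith
    exact_mod_cast this
  set L := Real.logb 2 m with hL
  have hL0 : 0 ≤ L := Real.logb_nonneg (by norm_num) (by linarith)
  have hLlog : 3 * L ≤ 5 * Real.log m := by
    rw [hL, Real.logb, mul_div_assoc', div_le_iff₀ (Real.log_pos (by norm_num))]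
    nlinarith [Real.log_two_gt_d9]
  set s := ⌈3 * (T + L)⌉₊ with hs
  have hs1 : 3 * (T + L) ≤ s := Nat.le_ceil _
  have hs2 : (s : ℝ) ≤ 4 * T + 5 * Real.log m := by
    have := Nat.ceil_lt_add_one (show 0 ≤ 3 * (T + L) by positivity)
    linarith
  have hgood : Good m N (fun z => (1 / N : ℝ) * ∑ j ∈ Finset.range N,
      ((Polynomial.Chebyshev.T ℝ j).eval (1 + (-(1 / m : ℝ)) * hw z)) ^ 2) := by
    refine Good.avg hN0 (fun j z =>
      ((Polynomial.Chebyshev.T ℝ j).eval (1 + (-(1 / m : ℝ)) * hw z)) ^ 2) fun j hj => ?_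
    refine Good.mono (Good.cheb j (1 / m) (by positivity) ?_) hj.le
    field_simp
    norm_num
  refine ⟨N * s, _, hgood.pow s, ?_, fun z hz => ?_⟩
  · push_cast
    calc (N : ℝ) * s ≤ (3 * q) * (4 * T + 5 * Real.log m) := by gcongr
      _ ≤ (3 * q) * (T * (4 + 5 * Real.log m)) := by
        gcongr
        nlinarith
      _ = 3 * (q * T) * (4 + 5 * Real.log m) := by ring
      _ = _ := by rw [hqT]
  · have hzm : (hw z : ℝ) ≤ m := by exact_mod_cast hw_le z
    set u := (hw z : ℝ) / m with hu
    have hu1 : u ≤ 1 := by rw [hu, div_le_one hm0]; exact hzm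
    have hu0 : T / m ≤ u := by rw [hu]; gcongr
    have hTm0 : 0 < T / m := by positivity
    have ey : 1 + (-(1 / m : ℝ)) * hw z = 1 - u := by rw [hu]; ring
    have hb : (1 / N : ℝ) * ∑ j ∈ Finset.range N,
        ((Polynomial.Chebyshev.T ℝ j).eval (1 + (-(1 / m : ℝ)) * hw z)) ^ 2 ≤ 3 / 4 := by
      rw [ey]
      refine avg_bound N hN0 _ (by linarith) (by linarith) ?_
      have h1 : T / m ≤ 1 - (1 - u) ^ 2 := by nlinarith
      have h2 : (2 * q) ^ 2 ≤ (N : ℝ) ^ 2 := by gcongr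
      calc (4 : ℝ) = (2 * q) ^ 2 * (T / m) := by
            rw [← hqsq]
            have : q ≠ 0 := by linarith
            field_simp
            norm_num
        _ ≤ (N : ℝ) ^ 2 * (1 - (1 - u) ^ 2) := by gcongr
    have hnn := hgood.nonneg z
    refine (pow_le_pow_left₀ hnn hb s).trans ?_
    calc ((3 : ℝ) / 4) ^ s = ((3 : ℝ) / 4) ^ (s : ℝ) := (Real.rpow_natCast _ _).symm
      _ ≤ ((3 : ℝ) / 4) ^ (3 * (T + L)) :=
          Real.rpow_le_rpow_of_exponent_ge (by norm_num) (by norm_num) hs1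
      _ = (((3 : ℝ) / 4) ^ (3 : ℝ)) ^ (T + L) := Real.rpow_mul (by norm_num) _ _
      _ ≤ ((2 : ℝ)⁻¹) ^ (T + L) := by
          refine Real.rpow_le_rpow (by positivity) ?_ (by positivity)
          norm_num
      _ = 2 ^ (-T) / m := by
          rw [Real.inv_rpow (by norm_num), ← Real.rpow_neg (by norm_num), neg_add,
            Real.rpow_add (by norm_num), Real.rpow_neg (by norm_num) L, hL,
            Real.rpow_logb (by norm_num) (by norm_num) hm0]
          rfl

end SosAux

theorem approx_weight_minus_one (ε : ℝ) (hε : 0 < ε) :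
    ∃ C : ℝ, 0 < C ∧
      ∀ m : ℕ, 2 ≤ m →
        ∃ f : (Fin m → Bool) → ℝ,
          (∀ z, 0 ≤ f z) ∧
          (∃ d : ℕ, (d : ℝ) ≤ C * (m : ℝ) ^ ((1 : ℝ) / 2 + ε) * Real.log m ∧
            HasSosDeg m d f) ∧
          f (fun _ => false) = 0 ∧
          (∀ z, 1 ≤ hw z → (hw z : ℝ) ≤ (m : ℝ) ^ (2 * ε) → f z = (hw z : ℝ) - 1) ∧
          (∀ z, (m : ℝ) ^ (2 * ε) < (hw z : ℝ) →
            (hw z : ℝ) - 1 - 2 ^ (-((m : ℝ) ^ (2 * ε))) ≤ f z ∧ f z ≤ (hw z : ℝ) - 1) := by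
  refine ⟨45, by norm_num, fun m hm => ?_⟩
  have hm2 : (2 : ℝ) ≤ m := by exact_mod_cast hm
  have hm0 : (0 : ℝ) < m := by linarith
  set T := (m : ℝ) ^ (2 * ε) with hTdef
  have hT : 1 ≤ T := Real.one_le_rpow (by linarith) (by linarith)
  have hM : (m : ℝ) ^ ((1 : ℝ) / 2 + ε) = Real.sqrt m * Real.sqrt T := by
    rw [Real.rpow_add hm0, Real.sqrt_eq_rpow, Real.sqrt_eq_rpow, hTdef, ← Real.rpow_mul hm0.le]
    congr 2
    ring
  obtain ⟨d₁, p₁, hg₁, hd₁, hz₁⟩ := SosAux.exists_roots (m := m) (min ⌊T⌋₊ m) (min_le_right _ _)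
  obtain ⟨d₂, p₂, hg₂, hd₂, hz₂⟩ := SosAux.exists_small hm T hT
  have hg := hg₁.mul hg₂
  obtain ⟨-, r, hr, hpr⟩ := id hg
  have hf : ∀ z, (hw z : ℝ) * ((hw z : ℝ) - 1) * r z = ((hw z : ℝ) - 1) * (1 - p₁ z * p₂ z) := by
    intro z
    rw [hpr z]
    ring
  have hsos := SosAux.mul SosAux.sos_pair hr
  refine ⟨_, SosAux.nonneg hsos, ⟨_, ?_, hsos⟩, ?_, ?_, ?_⟩
  · have hJ : Real.sqrt ((min ⌊T⌋₊ m : ℕ) : ℝ) ≤ Real.sqrt T := by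
      refine Real.sqrt_le_sqrt ?_
      refine le_trans ?_ (Nat.floor_le (show 0 ≤ T by linarith))
      exact_mod_cast min_le_left _ _
    rw [hM]
    have hs1 : 1 ≤ Real.sqrt m := Real.one_le_sqrt.2 (by linarith)
    have hs2 : 1 ≤ Real.sqrt T := Real.one_le_sqrt.2 hT
    have hlog : Real.log 2 ≤ Real.log m := Real.log_le_log (by norm_num) hm2
    have hl2 := Real.log_two_gt_d9
    have hd₁' : (d₁ : ℝ) ≤ 4 * (Real.sqrt m * Real.sqrt T) := by
      rw [← mul_assoc]
      exact hd₁.trans (by gcongr)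
    push_cast
    have hM1 : 1 ≤ Real.sqrt m * Real.sqrt T := by nlinarith
    set M := Real.sqrt m * Real.sqrt T
    nlinarith
  · simp [hw]
  · intro z h1 h2
    have : p₁ z = 0 := hz₁ z h1 (le_min (Nat.le_floor h2) (SosAux.hw_le z))
    rw [hf z, this]
    ring
  · intro z hz
    have hzm : (hw z : ℝ) ≤ m := by exact_mod_cast SosAux.hw_le z
    have h2 := hz₂ z hz
    have hp0 := hg.nonneg z
    have hp1 : p₁ z * p₂ z ≤ 2 ^ (-T) / m :=
      (mul_le_of_le_one_left (hg₂.nonneg z) (hg₁.le_one z)).trans h2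
    have hw1 : 0 ≤ (hw z : ℝ) - 1 := by linarith
    rw [hf z]
    have hpos : (0 : ℝ) < 2 ^ (-T) := by positivity
    have h3 : ((hw z : ℝ) - 1) * (p₁ z * p₂ z) ≤ 2 ^ (-T) :=
      calc ((hw z : ℝ) - 1) * (p₁ z * p₂ z) ≤ m * (2 ^ (-T) / m) := by
            gcongr
            linarith
        _ = 2 ^ (-T) := by field_simp
    have h4 := mul_nonneg hw1 hp0
    constructor <;> linarith
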